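/- arXiv:math/0611760 — 4 statements merged into one kernel-verified Lean document; each statement's English description precedes it below -/
import Mathlib

section
/- Let T be a triangulated category, S a class of objects of T, m ≤ n integers, A an abelian category, and H : T → A a cohomological functor. Let a ≤ b be integers. If for every object F ∈ S one has H(F[−i]) = 0 for all integers i with a ≤ i ≤ b, then for every E ∈ S[m,n] one has H(E[−j]) = 0 for all integers j with a − m ≤ j ≤ b − n. -/
/-!
Common setup: for a triangulated category `T`, a class of objects `S` and integers
`m ≤ n`, `SmnMem S m n E` expresses that `E` belongs to `S[m,n]`, the smallest full
subcategory of `T` containing `0`, containing `E⟦-ℓ⟧` (that is, `E[-ℓ]`) for every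
`E ∈ S` and every integer `ℓ` with `m ≤ ℓ ≤ n`, and such that for every distinguished
triangle `E ⟶ F ⟶ G ⟶ E⟦1⟧`, if `E` and `G` lie in it then so does `F`.
(Membership in a full subcategory is determined by the class of objects.)
-/

open CategoryTheory CategoryTheory.Limits CategoryTheory.Pretriangulated

universe w v u v₁ u₁

/-- Membership in the subcategory `S[m,n]` of Lipman–Neeman, Definition 5.1. -/
inductive SmnMem {T : Type u} [Category.{v} T] [HasZeroObject T] [Preadditive T]
    [HasShift T ℤ] [∀ n : ℤ, (shiftFunctor T n).Additive] [Pretriangulated T]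
    (S : Set T) (m n : ℤ) : T → Prop
  | zero (Z : T) (hZ : IsZero Z) : SmnMem S m n Z
  | shift (E : T) (hE : E ∈ S) (ℓ : ℤ) (h₁ : m ≤ ℓ) (h₂ : ℓ ≤ n) : SmnMem S m n (E⟦(-ℓ : ℤ)⟧)
  | ext (Tr : Triangle T) (hTr : Tr ∈ distTriang T)
      (h₁ : SmnMem S m n Tr.obj₁) (h₃ : SmnMem S m n Tr.obj₃) : SmnMem S m n Tr.obj₂

/-- **Remark 5.4(iii) of Lipman–Neeman.** Let `H : T ⥤ A` be a cohomological functor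
(an additive functor sending each distinguished triangle `X ⟶ Y ⟶ Z ⟶ X⟦1⟧` to an exact
sequence `H(X) ⟶ H(Y) ⟶ H(Z)`). If `H(F[−i]) = 0` for every `F ∈ S` and every
`i ∈ [a,b]`, then `H(E[−j]) = 0` for every `E ∈ S[m,n]` and every `j ∈ [a−m, b−n]`. -/
theorem statement_7 {T : Type u} [Category.{v} T] [HasZeroObject T] [Preadditive T]
    [HasShift T ℤ] [∀ n : ℤ, (shiftFunctor T n).Additive] [Pretriangulated T]
    [IsTriangulated T]
    {A : Type u₁} [Category.{v₁} A] [Abelian A]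
    (H : T ⥤ A) [H.Additive]
    (hH : ∀ (Tr : Triangle T), Tr ∈ (distTriang T) →
      ∀ (w : H.map Tr.mor₁ ≫ H.map Tr.mor₂ = 0), (ShortComplex.mk _ _ w).Exact)
    (S : Set T) (m n : ℤ) (hmn : m ≤ n) (a b : ℤ) (hab : a ≤ b)
    (hvan : ∀ F ∈ S, ∀ i : ℤ, a ≤ i → i ≤ b → IsZero (H.obj (F⟦(-i : ℤ)⟧)))
    (E : T) (hE : SmnMem S m n E) :
    ∀ j : ℤ, a - m ≤ j → j ≤ b - n → IsZero (H.obj (E⟦(-j : ℤ)⟧)) := by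
  induction hE with
  | zero Z hZ =>
    intro j _ _
    exact H.map_isZero ((shiftFunctor T (-j)).map_isZero hZ)
  | shift F hF ℓ h₁ h₂ =>
    intro j hj₁ hj₂
    exact (hvan F hF (ℓ + j) (by lia) (by lia)).of_iso
      (H.mapIso ((shiftFunctorAdd' T (-ℓ) (-j) (-(ℓ + j)) (by lia)).app F)).symm
  | ext Tr hTr _ _ ih₁ ih₃ =>
    intro j hj₁ hj₂
    have hTr' := Tr.shift_distinguished hTr (-j)
    have w : H.map ((shiftFunctor (Triangle T) (-j)).obj Tr).mor₁ ≫
        H.map ((shiftFunctor (Triangle T) (-j)).obj Tr).mor₂ = 0 := by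
      rw [← H.map_comp, comp_distTriang_mor_zero₁₂ _ hTr', H.map_zero]
    exact (hH _ hTr' w).isZero_of_both_zeros
      ((ih₁ j hj₁ hj₂).eq_of_src _ _) ((ih₃ j hj₁ hj₂).eq_of_tgt _ _)
end

section
/- Let R be a commutative ring, f = (f_1, …, f_r) a sequence in R, and E an R-complex all of whose homology modules H^i(E) are fR-torsion. Then for every morphism λ : R → E in D(R) there exists an integer n > 0 such that λ factors in D(R) as the canonical map R → K_•(f_1^n, …, f_r^n) followed by some D(R)-morphism K_•(f_1^n, …, f_r^n) → E. -/
/-!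
Koszul complexes (cohomologically indexed, over the category of `R`-modules).
For `f ∈ R` and a complex `E`, the tensor product `K_•(f) ⊗_R E` is (naturally isomorphic
to) the mapping cone of multiplication by `f` on `E`; accordingly the tensor product
`K_•(f₁, …, f_r) ⊗_R P` is defined as an iterated mapping cone, and the Koszul complex
`K_•(f₁, …, f_r)` is the case `P = R` (the ring placed in degree `0`).
-/

open CategoryTheory

universe u

noncomputable section

variable (R : Type u) [CommRing R]

/-- The complex consisting of `R` placed in degree `0`. -/
def singleR : CochainComplex (ModuleCat.{u} R) ℤ :=
  (HomologicalComplex.single (ModuleCat.{u} R) (ComplexShape.up ℤ) 0).obj (ModuleCat.of R R)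

/-- `koszulTensor R l P` is the tensor product `K_•(l) ⊗_R P` of the Koszul complex on the
list `l` with the complex `P`, defined as the iterated mapping cone of multiplication by
the elements of `l` on `P`. -/
def koszulTensor : List R → CochainComplex (ModuleCat.{u} R) ℤ →
    CochainComplex (ModuleCat.{u} R) ℤ
  | [], P => P
  | f :: fs, P => CochainComplex.mappingCone ((f • 𝟙 (koszulTensor fs P)))

/-- The Koszul complex `K_•(l)` on a list `l` of elements of `R`. -/
def koszul (l : List R) : CochainComplex (ModuleCat.{u} R) ℤ := koszulTensor R l (singleR R)

/-- The canonical map `P = R ⊗_R P ⟶ K_•(l) ⊗_R P` induced by the map of complexes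
`R → K_•(l)` which is the identity in degree `0`. -/
def koszulTensorUnit : (l : List R) → (P : CochainComplex (ModuleCat.{u} R) ℤ) →
    (P ⟶ koszulTensor R l P)
  | [], P => 𝟙 P
  | f :: fs, P =>
      koszulTensorUnit fs P ≫ CochainComplex.mappingCone.inr (f • 𝟙 (koszulTensor R fs P))

/-- A module `M` is `I`-torsion if every element of `M` is annihilated by some power of
the ideal `I`. -/
def IsIdealTorsion (I : Ideal R) (M : Type u) [AddCommGroup M] [Module R M] : Prop :=
  ∀ x : M, ∃ k : ℕ, ∀ a ∈ I ^ k, a • x = 0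

end

open DerivedCategory in
/-- In the derived category, every morphism from `R` to a complex with `g`-power torsion homology
in degree `0` is annihilated by a power of `g`. -/
lemma exists_pow_smul_eq_zero_of_singleR (R : Type u) [CommRing R]
    [HasDerivedCategory.{u + 1} (ModuleCat.{u} R)] (g : R)
    (E : CochainComplex (ModuleCat.{u} R) ℤ)
    (hE : ∀ x : E.homology 0, ∃ k : ℕ, g ^ k • x = 0)
    (φ : Q.obj (singleR R) ⟶ Q.obj E) :
    ∃ k : ℕ, g ^ k • φ = 0 := by
  have hproj : ∀ n : ℤ, Projective ((singleR R).X n) := by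
    intro n
    by_cases hn : n = 0
    · subst hn
      exact Projective.of_iso (HomologicalComplex.singleObjXSelf (ComplexShape.up ℤ) 0
        (ModuleCat.of R R)).symm inferInstance
    · exact (HomologicalComplex.isZero_single_obj_X (ComplexShape.up ℤ) 0
        (ModuleCat.of R R) n hn).projective
  have : (singleR R).IsStrictlyLE 0 :=
    inferInstanceAs (CochainComplex.IsStrictlyLE
      ((CochainComplex.singleFunctor (ModuleCat.{u} R) 0).obj (ModuleCat.of R R)) 0)
  have : (singleR R).IsKProjective := CochainComplex.isKProjective_of_projective _ 0
  obtain ⟨ψ', hψ'⟩ := (CochainComplex.IsKProjective.Qh_map_bijective (singleR R)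
    ((HomotopyCategory.quotient _ _).obj E)).surjective
      ((quotientCompQhIso _).hom.app _ ≫ φ ≫ (quotientCompQhIso _).inv.app _)
  obtain ⟨ψ, rfl⟩ := (HomotopyCategory.quotient _ _).map_surjective ψ'
  obtain rfl : φ = Q.map ψ := by
    rw [← cancel_epi ((quotientCompQhIso _).hom.app (singleR R)),
      ← quotientCompQhIso_hom_naturality, hψ']
    simp
  let e : (singleR R).X 0 ≅ ModuleCat.of R R :=
    HomologicalComplex.singleObjXSelf (ComplexShape.up ℤ) 0 (ModuleCat.of R R)
  let a : ModuleCat.of R R ⟶ E.X 0 := e.inv ≫ ψ.f 0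
  have ha : a ≫ E.d 0 1 = 0 := by
    have h0 : (singleR R).d 0 1 = 0 := HomologicalComplex.single_obj_d _ _ _ _ _
    dsimp only [a]
    rw [Category.assoc, ψ.comm, h0, Limits.zero_comp, Limits.comp_zero]
  obtain ⟨k, hk⟩ := hE ((E.liftCycles a 1 (by simp) ha ≫ E.homologyπ 0).hom (1 : R))
  refine ⟨k, ?_⟩
  have hka : (g ^ k • a) ≫ E.d 0 1 = 0 := by rw [Linear.smul_comp, ha, smul_zero]
  have hlift : E.liftCycles (g ^ k • a) 1 (by simp) hka =
      g ^ k • E.liftCycles a 1 (by simp) ha := by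
    rw [← cancel_mono (E.iCycles 0)]
    simp
  have hzero : E.liftCycles (g ^ k • a) 1 (by simp) hka ≫ E.homologyπ 0 = 0 := by
    rw [hlift, Linear.smul_comp]
    ext
    exact hk
  obtain ⟨A, π, hπ, x, hx⟩ :=
    (E.liftCycles_comp_homologyπ_eq_zero_iff_up_to_refinements (-1) 0 1 (by simp) (by simp)
      _ hka).1 hzero
  obtain ⟨s, hs⟩ := Projective.factors (𝟙 (ModuleCat.of R R)) π
  have hb : (s ≫ x) ≫ E.d (-1) 0 = g ^ k • a := by
    rw [Category.assoc, ← hx, reassoc_of% hs]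
  rw [← Functor.map_smul, ← Q.map_zero]
  have hψ : CochainComplex.HomComplex.Cochain.ofHom (g ^ k • ψ) =
      CochainComplex.HomComplex.Cochain.fromSingleMk (g ^ k • a) (add_zero 0) := by
    refine (CochainComplex.HomComplex.Cochain.fromSingleEquiv (X := ModuleCat.of R R)
      (add_zero (0 : ℤ))).injective ?_
    rw [CochainComplex.HomComplex.Cochain.fromSingleEquiv_fromSingleMk]
    change e.inv ≫ (CochainComplex.HomComplex.Cochain.ofHom (g ^ k • ψ)).v 0 0 _ = _
    simp [a]
  refine Q_map_eq_of_homotopy _ <|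
    (CochainComplex.HomComplex.Cochain.equivHomotopy (g ^ k • ψ) 0).symm
      ⟨CochainComplex.HomComplex.Cochain.fromSingleMk (p := 0) (q := -1) (s ≫ x) (by simp), ?_⟩
  rw [CochainComplex.HomComplex.Cochain.ofHom_zero, add_zero, hψ, ← hb]
  exact (CochainComplex.HomComplex.Cochain.δ_fromSingleMk ..).symm

open DerivedCategory in
lemma exists_eq_mappingCone_inr_comp {C : Type*} [Category* C] [Abelian C]
    [HasDerivedCategory C] {K L : CochainComplex C ℤ} (φ : K ⟶ L) {Z : DerivedCategory C}
    (g : Q.obj L ⟶ Z) (hg : Q.map φ ≫ g = 0) :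
    ∃ g' : Q.obj (CochainComplex.mappingCone φ) ⟶ Z,
      g = Q.map (CochainComplex.mappingCone.inr φ) ≫ g' :=
  Pretriangulated.Triangle.yoneda_exact₂ _ (mappingCone_triangle_distinguished φ) g hg

open DerivedCategory in
lemma exists_eq_comp_shift_of_mappingCone_inr_comp {C : Type*} [Category* C] [Abelian C]
    [HasDerivedCategory C] {K L : CochainComplex C ℤ} (φ : K ⟶ L) {Z : DerivedCategory C}
    (g : Q.obj (CochainComplex.mappingCone φ) ⟶ Z)
    (hg : Q.map (CochainComplex.mappingCone.inr φ) ≫ g = 0) :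
    ∃ (δ : Q.obj (CochainComplex.mappingCone φ) ⟶ (Q.obj K)⟦(1 : ℤ)⟧)
      (ψ : (Q.obj K)⟦(1 : ℤ)⟧ ⟶ Z), g = δ ≫ ψ :=
  ⟨_, Pretriangulated.Triangle.yoneda_exact₃ _ (mappingCone_triangle_distinguished φ) g hg⟩

lemma exists_pow_smul_eq_zero_of_iso {R : Type u} [CommRing R] {M N : ModuleCat.{u} R}
    (e : M ≅ N) (g : R) (hN : ∀ x : N, ∃ k : ℕ, g ^ k • x = 0) (x : M) :
    ∃ k : ℕ, g ^ k • x = 0 := by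
  obtain ⟨k, hk⟩ := hN (e.toLinearEquiv x)
  exact ⟨k, e.toLinearEquiv.injective (by rw [map_smul, hk, map_zero])⟩

open DerivedCategory in
/-- If every morphism from `K` or `L` to a complex with `g`-power torsion homology is annihilated
by a power of `g`, then the same holds for the mapping cone of a morphism `K ⟶ L`. -/
lemma exists_pow_smul_eq_zero_of_mappingCone (R : Type u) [CommRing R]
    [HasDerivedCategory.{u + 1} (ModuleCat.{u} R)] (g : R)
    {K L : CochainComplex (ModuleCat.{u} R) ℤ} (f : K ⟶ L)
    (hK : ∀ E : CochainComplex (ModuleCat.{u} R) ℤ,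
      (∀ (i : ℤ) (x : E.homology i), ∃ k : ℕ, g ^ k • x = 0) →
        ∀ φ : Q.obj K ⟶ Q.obj E, ∃ k : ℕ, g ^ k • φ = 0)
    (hL : ∀ E : CochainComplex (ModuleCat.{u} R) ℤ,
      (∀ (i : ℤ) (x : E.homology i), ∃ k : ℕ, g ^ k • x = 0) →
        ∀ φ : Q.obj L ⟶ Q.obj E, ∃ k : ℕ, g ^ k • φ = 0)
    (E : CochainComplex (ModuleCat.{u} R) ℤ)
    (hE : ∀ (i : ℤ) (x : E.homology i), ∃ k : ℕ, g ^ k • x = 0)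
    (φ : Q.obj (CochainComplex.mappingCone f) ⟶ Q.obj E) :
    ∃ k : ℕ, g ^ k • φ = 0 := by
  obtain ⟨k₁, hk₁⟩ := hL E hE (Q.map (CochainComplex.mappingCone.inr f) ≫ φ)
  obtain ⟨δ, ψ, hψ⟩ := exists_eq_comp_shift_of_mappingCone_inr_comp f (g ^ k₁ • φ)
    (by rwa [Linear.comp_smul])
  let e : Q.obj E ≅ (Q.obj (E⟦(-1 : ℤ)⟧))⟦(1 : ℤ)⟧ :=
    Q.mapIso ((shiftEquiv _ (1 : ℤ)).counitIso.symm.app E) ≪≫ (Q.commShiftIso (1 : ℤ)).app _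
  obtain ⟨χ, hχ⟩ := (shiftFunctor (DerivedCategory (ModuleCat.{u} R)) (1 : ℤ)).map_surjective
    (ψ ≫ e.hom)
  obtain ⟨k₂, hk₂⟩ := hK (E⟦(-1 : ℤ)⟧) (fun i ↦ exists_pow_smul_eq_zero_of_iso
    ((CochainComplex.ShiftSequence.shiftIso (ModuleCat.{u} R) (-1) i (-1 + i) rfl).app E)
    g (hE _)) χ
  have hψ₂ : g ^ k₂ • ψ = 0 := by
    rw [← cancel_mono e.hom, Linear.smul_comp, ← hχ, ← Functor.map_smul, hk₂]
    simp
  exact ⟨k₂ + k₁, by rw [pow_add, mul_smul, hψ, ← Linear.comp_smul, hψ₂, Limits.comp_zero]⟩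

open DerivedCategory in
/-- In the derived category, every morphism from a Koszul complex to a complex with `g`-power
torsion homology is annihilated by a power of `g`. -/
lemma exists_pow_smul_eq_zero_of_koszulTensor (R : Type u) [CommRing R]
    [HasDerivedCategory.{u + 1} (ModuleCat.{u} R)] (g : R) (l : List R)
    (E : CochainComplex (ModuleCat.{u} R) ℤ)
    (hE : ∀ (i : ℤ) (x : E.homology i), ∃ k : ℕ, g ^ k • x = 0)
    (φ : Q.obj (koszulTensor R l (singleR R)) ⟶ Q.obj E) :
    ∃ k : ℕ, g ^ k • φ = 0 := by
  induction l generalizing E with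
  | nil => exact exists_pow_smul_eq_zero_of_singleR R g E (hE 0) φ
  | cons f l ih => exact exists_pow_smul_eq_zero_of_mappingCone R g _ ih ih E hE φ

/-- For `n ≤ m` the canonical map `P ⟶ K_•(l ^ n) ⊗ P` factors through the canonical map
`P ⟶ K_•(l ^ m) ⊗ P`. -/
lemma exists_koszulTensorUnit_comp (R : Type u) [CommRing R] {n m : ℕ} (h : n ≤ m) (l : List R)
    (P : CochainComplex (ModuleCat.{u} R) ℤ) :
    ∃ ρ : koszulTensor R (l.map (· ^ m)) P ⟶ koszulTensor R (l.map (· ^ n)) P,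
      koszulTensorUnit R (l.map (· ^ m)) P ≫ ρ = koszulTensorUnit R (l.map (· ^ n)) P := by
  induction l with
  | nil => exact ⟨𝟙 _, Category.comp_id _⟩
  | cons f l ih =>
    obtain ⟨ρ, hρ⟩ := ih
    refine ⟨CochainComplex.mappingCone.map _ _ (f ^ (m - n) • ρ) ρ ?_, ?_⟩
    · simp [smul_smul, ← pow_add, h]
    · change (koszulTensorUnit R (l.map (· ^ m)) P ≫ CochainComplex.mappingCone.inr _) ≫ _ =
        koszulTensorUnit R (l.map (· ^ n)) P ≫ CochainComplex.mappingCone.inr _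
      rw [← hρ, Category.assoc, Category.assoc]
      congr 1
      exact CochainComplex.mappingCone.inr_desc ..

open DerivedCategory in
/-- A morphism in the derived category from `R` to a complex whose homology is power torsion with
respect to every element of a list `l` factors through the Koszul complex on some power of `l`. -/
lemma exists_factor_koszulTensorUnit (R : Type u) [CommRing R]
    [HasDerivedCategory.{u + 1} (ModuleCat.{u} R)] (l : List R)
    (E : CochainComplex (ModuleCat.{u} R) ℤ)
    (hE : ∀ g ∈ l, ∀ (i : ℤ) (x : E.homology i), ∃ k : ℕ, g ^ k • x = 0)
    (lam : Q.obj (singleR R) ⟶ Q.obj E) :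
    ∃ n : ℕ, 0 < n ∧
      ∃ μ : Q.obj (koszulTensor R (l.map (· ^ n)) (singleR R)) ⟶ Q.obj E,
        lam = Q.map (koszulTensorUnit R (l.map (· ^ n)) (singleR R)) ≫ μ := by
  induction l with
  | nil =>
    refine ⟨1, one_pos, lam, ?_⟩
    change lam = Q.map (𝟙 _) ≫ lam
    simp
  | cons f l ih =>
    obtain ⟨n, hn, μ, rfl⟩ := ih fun g hg ↦ hE g (List.mem_cons_of_mem _ hg)
    obtain ⟨k, hk⟩ := exists_pow_smul_eq_zero_of_koszulTensor R f _ E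
      (hE f List.mem_cons_self) μ
    obtain ⟨ρ, hρ⟩ := exists_koszulTensorUnit_comp R (Nat.le_add_right n k) l (singleR R)
    obtain ⟨ν, hν⟩ := exists_eq_mappingCone_inr_comp
      (f ^ (n + k) • 𝟙 (koszulTensor R (l.map (· ^ (n + k))) (singleR R))) (Q.map ρ ≫ μ) (by
        rw [Functor.map_smul, CategoryTheory.Functor.map_id, Linear.smul_comp, Category.id_comp,
          ← Linear.comp_smul, pow_add, mul_smul, hk, smul_zero, Limits.comp_zero])
    refine ⟨n + k, by lia, ν, ?_⟩
    change _ = Q.map (koszulTensorUnit R (l.map (· ^ (n + k))) (singleR R) ≫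
      CochainComplex.mappingCone.inr _) ≫ ν
    rw [← hρ, Functor.map_comp, Category.assoc, hν, Functor.map_comp_assoc]

open DerivedCategory in
/-- **Lipman–Neeman, §5 (before Lemma 5.7).** Let `R` be a commutative ring,
`f = (f₁, …, f_r)` a sequence in `R`, and `E` an `R`-complex all of whose homology
modules are `fR`-torsion. Then every morphism `λ : R ⟶ E` in `D(R)` factors, for some
`n > 0`, through the canonical map `R ⟶ K_•(f₁ⁿ, …, f_rⁿ)`. -/
theorem statement_13 (R : Type u) [CommRing R]
    [HasDerivedCategory.{u + 1} (ModuleCat.{u} R)]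
    (r : ℕ) (f : Fin r → R)
    (E : CochainComplex (ModuleCat.{u} R) ℤ)
    (hE : ∀ i : ℤ, IsIdealTorsion R (Ideal.span (Set.range f)) (E.homology i))
    (lam : Q.obj (singleR R) ⟶ Q.obj E) :
    ∃ n : ℕ, 0 < n ∧
      ∃ μ : Q.obj (koszulTensor R (List.ofFn fun i => f i ^ n) (singleR R)) ⟶ Q.obj E,
        lam = Q.map (koszulTensorUnit R (List.ofFn fun i => f i ^ n) (singleR R)) ≫ μ := by
  obtain ⟨n, hn, h⟩ := exists_factor_koszulTensorUnit R (List.ofFn f) E (fun g hg i x ↦ by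
    obtain ⟨k, hk⟩ := hE i x
    obtain ⟨j, rfl⟩ := List.mem_ofFn.1 hg
    exact ⟨k, hk _ (Ideal.pow_mem_pow (Ideal.subset_span (Set.mem_range_self j)) k)⟩) lam
  rw [List.map_ofFn] at h
  exact ⟨n, hn, h⟩
end

section
/- Let R be a commutative ring, f = (f_1, …, f_r) a sequence in R, P a bounded complex of finitely generated projective R-modules, and E an R-complex all of whose homology modules H^i(E) are fR-torsion. Then for every morphism λ : P → E in D(R) there exists an integer n > 0 such that λ factors in D(R) as the natural map P = R ⊗_R P → K_•(f_1^n, …, f_r^n) ⊗_R P followed by some D(R)-morphism K_•(f_1^n, …, f_r^n) ⊗_R P → E. -/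
/-!
Koszul complexes (cohomologically indexed, over the category of `R`-modules).
For `f ∈ R` and a complex `E`, the tensor product `K_•(f) ⊗_R E` is (naturally isomorphic
to) the mapping cone of multiplication by `f` on `E`; accordingly the tensor product
`K_•(f₁, …, f_r) ⊗_R P` is defined as an iterated mapping cone, and the Koszul complex
`K_•(f₁, …, f_r)` is the case `P = R` (the ring placed in degree `0`).
-/

open CategoryTheory

universe u

section

open CategoryTheory.Limits

variable {R : Type u} [CommRing R]

/-- A power of `a` kills every linear map from a finite module to an `a`-power torsion module. -/
lemma exists_pow_smul_eq_zero_of_finite {M N : Type*} [AddCommGroup M] [Module R M]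
    [AddCommGroup N] [Module R N] [Module.Finite R M] (a : R)
    (hN : ∀ x : N, ∃ k : ℕ, a ^ k • x = 0) (φ : M →ₗ[R] N) :
    ∃ n : ℕ, a ^ n • φ = 0 := by
  obtain ⟨s, hs⟩ := Module.Finite.fg_top (R := R) (M := M)
  choose k hk using hN
  refine ⟨s.sup fun x => k (φ x), LinearMap.ext_on hs fun x hx => ?_⟩
  obtain ⟨m, hm⟩ := Nat.exists_eq_add_of_le (Finset.le_sup (f := fun x => k (φ x)) hx)
  simp only [LinearMap.smul_apply, LinearMap.zero_apply]
  rw [hm, pow_add, mul_comm, mul_smul, hk, smul_zero]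

/-- If the homology of `E` in degree `j` is `a`-power torsion, then every cycle-valued morphism
from a finite projective module becomes a boundary after multiplication by a power of `a`. -/
lemma exists_pow_smul_eq_comp_d {M : ModuleCat.{u} R} [Module.Finite R M] [Module.Projective R M]
    (E : CochainComplex (ModuleCat.{u} R) ℤ) (a : R) {i j : ℤ} (hij : i + 1 = j)
    (hE : ∀ x : E.homology j, ∃ k : ℕ, a ^ k • x = 0) (φ : M ⟶ E.X j)
    (hφ : φ ≫ E.d j (j + 1) = 0) :
    ∃ (n : ℕ) (h : M ⟶ E.X i), h ≫ E.d i j = a ^ n • φ := by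
  let ψ : M ⟶ E.cycles j := E.liftCycles φ (j + 1) (by simp) hφ
  obtain ⟨n, hn⟩ := exists_pow_smul_eq_zero_of_finite a hE (ψ ≫ E.homologyπ j).hom
  have hn' : (a ^ n • ψ) ≫ E.homologyπ j = 0 := by
    ext1
    rw [Linear.smul_comp, ModuleCat.hom_smul, hn, ModuleCat.hom_zero]
  have : Projective M := M.projective_of_categoryTheory_projective
  let S := ShortComplex.mk (E.toCycles i j) (E.homologyπ j) (by simp)
  have hS : S.Exact := S.exact_of_g_is_cokernel
    (E.homologyIsCokernel i j ((ComplexShape.up ℤ).prev_eq' hij))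
  refine ⟨n, hS.liftFromProjective (a ^ n • ψ) hn', ?_⟩
  have h := hS.liftFromProjective_comp (a ^ n • ψ) hn'
  have := congrArg (· ≫ E.iCycles j) h
  simpa [S, ψ] using this

/-- A morphism of complexes which vanishes in degrees `> i` is homotopic, up to a power of `a`,
to one which vanishes in degrees `≥ i`. -/
lemma exists_homotopy_pow_smul_step {P E : CochainComplex (ModuleCat.{u} R) ℤ}
    (hP : ∀ i : ℤ, Module.Finite R (P.X i) ∧ Module.Projective R (P.X i))
    (a : R) (hE : ∀ (i : ℤ) (x : E.homology i), ∃ k : ℕ, a ^ k • x = 0)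
    (g : P ⟶ E) (i : ℤ) (hg : ∀ j, i < j → g.f j = 0) :
    ∃ (n : ℕ) (g' : P ⟶ E), Nonempty (Homotopy (a ^ n • g) g') ∧ ∀ j, i ≤ j → g'.f j = 0 := by
  obtain ⟨_, _⟩ := hP i
  obtain ⟨n, h, hh⟩ := exists_pow_smul_eq_comp_d E a (sub_add_cancel i 1) (hE i) (g.f i)
    (by rw [g.comm, hg _ (by lia), comp_zero])
  let hom : ∀ p q : ℤ, (ComplexShape.up ℤ).Rel q p → (P.X p ⟶ E.X q) := fun p q hpq =>
    if hp : p = i then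
      (P.XIsoOfEq hp).hom ≫ h ≫ (E.XIsoOfEq (by rw [← hp, ← hpq]; simp)).hom
    else 0
  have hom_ne (p q : ℤ) (hpq) (hp : p ≠ i) : hom p q hpq = 0 := dif_neg hp
  have hom_eq (hpq) : hom i (i - 1) hpq = h := by simp [hom]
  let N : P ⟶ E := Homotopy.nullHomotopicMap' hom
  refine ⟨n, a ^ n • g - N, ⟨?_⟩, fun j hj => ?_⟩
  · exact (Homotopy.equivSubZero).symm
      ((Homotopy.ofEq (by abel)).trans (Homotopy.nullHomotopy' hom))
  · have h₁ : (ComplexShape.up ℤ).Rel (j - 1) j := by simp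
    have h₂ : (ComplexShape.up ℤ).Rel j (j + 1) := by simp
    have hN : N.f j = P.d j (j + 1) ≫ hom (j + 1) j h₂ + hom j (j - 1) h₁ ≫ E.d (j - 1) j :=
      Homotopy.nullHomotopicMap'_f h₁ h₂ hom
    rw [hom_ne (j + 1) j h₂ (Int.lt_add_one_of_le hj).ne', comp_zero, zero_add] at hN
    simp only [HomologicalComplex.sub_f_apply, HomologicalComplex.smul_f_apply, hN]
    obtain rfl | hj := hj.eq_or_lt
    · rw [hom_eq h₁, hh, sub_self]
    · rw [hom_ne _ _ h₁ hj.ne', hg _ hj, zero_comp, smul_zero, sub_zero]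

/-- A complex of modules is strictly perfect if it is bounded with finite projective terms. -/
def IsStrictlyPerfect (P : CochainComplex (ModuleCat.{u} R) ℤ) : Prop :=
  (∃ a b : ℤ, ∀ i : ℤ, (i < a ∨ b < i) → IsZero (P.X i)) ∧
    ∀ i : ℤ, Module.Finite R (P.X i) ∧ Module.Projective R (P.X i)

namespace IsStrictlyPerfect

variable {P : CochainComplex (ModuleCat.{u} R) ℤ}

lemma exists_homotopy_pow_smul_zero (hP : IsStrictlyPerfect P)
    {E : CochainComplex (ModuleCat.{u} R) ℤ}
    (a : R) (hE : ∀ (i : ℤ) (x : E.homology i), ∃ k : ℕ, a ^ k • x = 0) (g : P ⟶ E) :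
    ∃ n : ℕ, Nonempty (Homotopy (a ^ n • g) 0) := by
  obtain ⟨⟨l, b, hlb⟩, hfp⟩ := hP
  have key (k : ℕ) : ∃ (n : ℕ) (g' : P ⟶ E), Nonempty (Homotopy (a ^ n • g) g') ∧
      ∀ j, b - k < j → g'.f j = 0 := by
    induction k with
    | zero =>
      exact ⟨0, g, ⟨Homotopy.ofEq (by simp)⟩,
        fun j hj => (hlb j (Or.inr (by simpa using hj))).eq_of_src _ _⟩
    | succ k ih =>
      obtain ⟨n, g', ⟨e⟩, hg'⟩ := ih
      obtain ⟨m, g'', ⟨e'⟩, hg''⟩ := exists_homotopy_pow_smul_step hfp a hE g' _ hg'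
      refine ⟨m + n, g'', ⟨?_⟩, fun j hj => hg'' j (by push_cast at hj; lia)⟩
      exact (Homotopy.ofEq (by rw [pow_add, mul_smul])).trans ((e.smul (a ^ m)).trans e')
  obtain ⟨n, g', ⟨e⟩, hg'⟩ := key (b - l + 1).toNat
  refine ⟨n, ⟨e.trans (Homotopy.ofEq ?_)⟩⟩
  ext1 j
  by_cases hj : j < l
  · exact (hlb j (Or.inl hj)).eq_of_src _ _
  · exact hg' j (by lia)

lemma mappingCone (hP : IsStrictlyPerfect P) (φ : P ⟶ P) :
    IsStrictlyPerfect (CochainComplex.mappingCone φ) := by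
  obtain ⟨⟨l, b, hlb⟩, hfp⟩ := hP
  refine ⟨⟨l - 1, b, fun i hi => ?_⟩, fun i => ?_⟩
  · rw [CochainComplex.mappingCone.isZero_X_iff]
    exact ⟨hlb _ (by lia), hlb _ (by lia)⟩
  · let e := ((HomologicalComplex.homotopyCofiber.XIsoBiprod φ i (i + 1) rfl) ≪≫
      ModuleCat.biprodIsoProd _ _).toLinearEquiv
    obtain ⟨_, _⟩ := hfp i
    obtain ⟨_, _⟩ := hfp (i + 1)
    exact ⟨Module.Finite.equiv e.symm, Module.Projective.of_equiv e.symm⟩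

lemma koszulTensor (hP : IsStrictlyPerfect P) (l : List R) :
    IsStrictlyPerfect (koszulTensor R l P) := by
  induction l with
  | nil => exact hP
  | cons a l ih => exact ih.mappingCone _

end IsStrictlyPerfect

/-- Koszul complexes on termwise multiples map to the original ones, compatibly with the
canonical maps from `P`. -/
lemma exists_koszulTensorUnit_comp_eq (P : CochainComplex (ModuleCat.{u} R) ℤ) {l l' : List R}
    (h : List.Forall₂ (· ∣ ·) l l') :
    ∃ φ : koszulTensor R l' P ⟶ koszulTensor R l P,
      koszulTensorUnit R l' P ≫ φ = koszulTensorUnit R l P := by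
  induction h with
  | nil => exact ⟨𝟙 _, Category.comp_id _⟩
  | @cons a a' l l' haa' _ ih =>
    obtain ⟨c, rfl⟩ := haa'
    obtain ⟨φ, hφ⟩ := ih
    have comm : ((a * c) • 𝟙 (koszulTensor R l' P)) ≫ φ =
        (c • φ) ≫ (a • 𝟙 (koszulTensor R l P)) := by
      simp [smul_smul]
    refine ⟨CochainComplex.mappingCone.map _ _ (c • φ) φ comm, ?_⟩
    change (koszulTensorUnit R l' P ≫ CochainComplex.mappingCone.inr _) ≫
        CochainComplex.mappingCone.map _ _ (c • φ) φ comm =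
      koszulTensorUnit R l P ≫ CochainComplex.mappingCone.inr _
    rw [← hφ, Category.assoc, Category.assoc, CochainComplex.mappingCone.map,
      CochainComplex.mappingCone.inr_desc]

section

open DerivedCategory

variable [HasDerivedCategory (ModuleCat.{u} R)]

lemma IsStrictlyPerfect.exists_Q_map_pow_smul_comp_eq_zero
    {P : CochainComplex (ModuleCat.{u} R) ℤ} (hP : IsStrictlyPerfect P)
    {E : CochainComplex (ModuleCat.{u} R) ℤ} (a : R)
    (hE : ∀ (i : ℤ) (x : E.homology i), ∃ k : ℕ, a ^ k • x = 0) (lam : Q.obj P ⟶ Q.obj E) :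
    ∃ n : ℕ, Q.map (a ^ n • 𝟙 P) ≫ lam = 0 := by
  obtain ⟨E', g, s, hs, rfl⟩ := left_fac lam
  have : QuasiIso s := (isIso_Q_map_iff_quasiIso _ s).1 hs
  have hE' (i : ℤ) (x : E'.homology i) : ∃ k : ℕ, a ^ k • x = 0 := by
    let e := (asIso (HomologicalComplex.homologyMap s i)).toLinearEquiv
    obtain ⟨k, hk⟩ := hE i (e.symm x)
    exact ⟨k, e.symm.injective (by rw [map_smul, hk, map_zero])⟩
  obtain ⟨n, ⟨e⟩⟩ := hP.exists_homotopy_pow_smul_zero a hE' g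
  refine ⟨n, ?_⟩
  rw [← Category.assoc, ← Q.map_comp, Linear.smul_comp, Category.id_comp,
    Q_map_eq_of_homotopy _ e, Functor.map_zero, zero_comp]

lemma exists_eq_Q_map_inr_comp {K L : CochainComplex (ModuleCat.{u} R) ℤ} (φ : K ⟶ L)
    {X : DerivedCategory (ModuleCat.{u} R)} (lam : Q.obj L ⟶ X) (h : Q.map φ ≫ lam = 0) :
    ∃ μ : Q.obj (CochainComplex.mappingCone φ) ⟶ X,
      lam = Q.map (CochainComplex.mappingCone.inr φ) ≫ μ :=
  Pretriangulated.Triangle.yoneda_exact₂ _ (mappingCone_triangle_distinguished φ) lam h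

/-- A morphism from a strictly perfect complex to a complex with `a`-power torsion homology for
all `a` in `l` factors through the Koszul complex on some powers of the elements of `l`. -/
lemma IsStrictlyPerfect.exists_eq_koszulTensorUnit_comp
    {P : CochainComplex (ModuleCat.{u} R) ℤ} (hP : IsStrictlyPerfect P)
    {E : CochainComplex (ModuleCat.{u} R) ℤ} (l : List R)
    (hE : ∀ a ∈ l, ∀ (i : ℤ) (x : E.homology i), ∃ k : ℕ, a ^ k • x = 0)
    (lam : Q.obj P ⟶ Q.obj E) :
    ∃ n : ℕ, 0 < n ∧ ∃ μ : Q.obj (_root_.koszulTensor R (l.map (· ^ n)) P) ⟶ Q.obj E,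
      lam = Q.map (koszulTensorUnit R (l.map (· ^ n)) P) ≫ μ := by
  induction l with
  | nil =>
    refine ⟨1, one_pos, lam, ?_⟩
    erw [Q.map_id, Category.id_comp]
  | cons a l ih =>
    obtain ⟨n, hn, μ, rfl⟩ := ih fun b hb => hE b (List.mem_cons_of_mem a hb)
    obtain ⟨m, hm⟩ := (hP.koszulTensor (l.map (· ^ n))).exists_Q_map_pow_smul_comp_eq_zero a
      (hE a List.mem_cons_self) μ
    obtain ⟨φ, hφ⟩ := exists_koszulTensorUnit_comp_eq P
      (l := l.map (· ^ n)) (l' := l.map (· ^ (n + m)))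
      (by simp [List.forall₂_map_left_iff, List.forall₂_map_right_iff, List.forall₂_same,
        pow_add])
    obtain ⟨ν, hν⟩ := exists_eq_Q_map_inr_comp
      (a ^ (n + m) • 𝟙 (_root_.koszulTensor R (l.map (· ^ (n + m))) P)) (Q.map φ ≫ μ) (by
        have : (a ^ (n + m) • 𝟙 (_root_.koszulTensor R (l.map (· ^ (n + m))) P)) ≫ φ =
            (a ^ n • φ) ≫ (a ^ m • 𝟙 _) := by
          simp [smul_smul, pow_add, mul_comm]
        rw [← Category.assoc, ← Q.map_comp, this, Q.map_comp, Category.assoc, hm, comp_zero])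
    refine ⟨n + m, by lia, ν, ?_⟩
    change _ = Q.map (koszulTensorUnit R (l.map (· ^ (n + m))) P ≫
      CochainComplex.mappingCone.inr _) ≫ ν
    rw [← hφ, Q.map_comp, Q.map_comp, Category.assoc, Category.assoc, hν]

end

end

open DerivedCategory CategoryTheory.Limits in
/-- **Lipman–Neeman, §5 (before Lemma 5.7).** Let `R` be a commutative ring,
`f = (f₁, …, f_r)` a sequence in `R`, `P` a bounded complex of finitely generated
projective `R`-modules, and `E` an `R`-complex all of whose homology modules are
`fR`-torsion.  Then every morphism `λ : P ⟶ E` in `D(R)` factors, for some `n > 0`,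
through the natural map `P = R ⊗_R P ⟶ K_•(f₁ⁿ, …, f_rⁿ) ⊗_R P`. -/
theorem statement_14 (R : Type u) [CommRing R]
    [HasDerivedCategory.{u + 1} (ModuleCat.{u} R)]
    (r : ℕ) (f : Fin r → R)
    (P : CochainComplex (ModuleCat.{u} R) ℤ)
    (hPbdd : ∃ a b : ℤ, ∀ i : ℤ, (i < a ∨ b < i) → IsZero (P.X i))
    (hPfgproj : ∀ i : ℤ, Module.Finite R (P.X i) ∧ Module.Projective R (P.X i))
    (E : CochainComplex (ModuleCat.{u} R) ℤ)
    (hE : ∀ i : ℤ, IsIdealTorsion R (Ideal.span (Set.range f)) (E.homology i))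
    (lam : Q.obj P ⟶ Q.obj E) :
    ∃ n : ℕ, 0 < n ∧
      ∃ μ : Q.obj (koszulTensor R (List.ofFn fun i => f i ^ n) P) ⟶ Q.obj E,
        lam = Q.map (koszulTensorUnit R (List.ofFn fun i => f i ^ n) P) ≫ μ := by
  have hP : IsStrictlyPerfect P := ⟨hPbdd, hPfgproj⟩
  obtain ⟨n, hn, h⟩ := hP.exists_eq_koszulTensorUnit_comp (List.ofFn f) (fun a ha i x => by
    obtain ⟨k, hk⟩ := hE i x
    exact ⟨k, hk _ (Ideal.pow_mem_pow (Ideal.subset_span (by simpa using ha)) k)⟩) lam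
  refine ⟨n, hn, ?_⟩
  rwa [List.map_ofFn] at h
end

section
/- Let R be a commutative ring, f = (f_1, …, f_r) a sequence in R, I = (f_1, …, f_r)R, and m an integer. Let E be an R-complex such that H^i(E) is I-torsion for all i ≥ m − r. Then for every integer i ≥ m with H^i(E) ≠ 0, there exists a nonzero morphism K_•(f_1, …, f_r)[−i] → E in D(R). -/
/-!
Koszul complexes (cohomologically indexed, over the category of `R`-modules).
For `f ∈ R` and a complex `E`, the tensor product `K_•(f) ⊗_R E` is (naturally isomorphic
to) the mapping cone of multiplication by `f` on `E`; accordingly the tensor product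
`K_•(f₁, …, f_r) ⊗_R P` is defined as an iterated mapping cone, and the Koszul complex
`K_•(f₁, …, f_r)` is the case `P = R` (the ring placed in degree `0`).
-/

open CategoryTheory

universe u

section

open CategoryTheory Limits

variable {C : Type*} [Category* C] [Abelian C]

/-- A morphism from a projective object, placed in degree `n`, which induces zero in homology
is homotopic to zero. -/
theorem CochainComplex.nonempty_homotopy_zero_of_homologyMap_eq_zero
    {P : C} [Projective P] {n : ℤ} {L : CochainComplex C ℤ}
    (g : (HomologicalComplex.single C (ComplexShape.up ℤ) n).obj P ⟶ L)
    (hg : HomologicalComplex.homologyMap g n = 0) : Nonempty (Homotopy g 0) := by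
  let S : ShortComplex C := ShortComplex.mk (L.toCycles (n - 1) n) (L.homologyπ n) (by simp)
  have hS : S.Exact := S.exact_of_g_is_cokernel (L.homologyIsCokernel (n - 1) n (by simp))
  let u : P ⟶ S.X₂ := (HomologicalComplex.singleObjCyclesSelfIso (ComplexShape.up ℤ) n P).inv ≫
    HomologicalComplex.cyclesMap g n
  have hu : u ≫ S.g = 0 := by
    simp only [u, S, Category.assoc, ← HomologicalComplex.homologyπ_naturality, hg, comp_zero]
  let v : P ⟶ L.X (n - 1) := hS.liftFromProjective u hu
  have hv : v ≫ L.d (n - 1) n =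
      (HomologicalComplex.singleObjXSelf (ComplexShape.up ℤ) n P).inv ≫ g.f n := by
    have h := hS.liftFromProjective_comp u hu =≫ L.iCycles n
    simpa [S, u, v] using h
  let α := HomComplex.Cochain.fromSingleMk v (n := -1) (sub_eq_add_neg n 1).symm
  have hα : HomComplex.δ (-1) 0 α = HomComplex.Cochain.ofHom g := by
    rw [HomComplex.Cochain.δ_fromSingleMk v _ 0 n (add_zero n), hv]
    apply (HomComplex.Cochain.fromSingleEquiv (add_zero n)).injective
    rw [HomComplex.Cochain.fromSingleEquiv_fromSingleMk]
    exact congrArg (_ ≫ ·) (HomComplex.Cochain.ofHom_v g n).symm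
  exact ⟨(HomComplex.Cochain.equivHomotopy g 0).symm
    ⟨α, by rw [HomComplex.Cochain.ofHom_zero, add_zero]; exact hα.symm⟩⟩

/-- A morphism from `P` to the cycles in degree `n` extends to a morphism of complexes from `P`
placed in degree `n`. -/
theorem HomologicalComplex.exists_single_hom {ι : Type*} {c : ComplexShape ι} [DecidableEq ι]
    {P : C} {n : ι} {L : HomologicalComplex C c} (w : P ⟶ L.cycles n) :
    ∃ g : (single C c n).obj P ⟶ L,
      (singleObjHomologySelfIso c n P).inv ≫ homologyMap g n = w ≫ L.homologyπ n := by
  let g : (single C c n).obj P ⟶ L := mkHomFromSingle (w ≫ L.iCycles n) (by simp)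
  refine ⟨g, ?_⟩
  have h : (singleObjCyclesSelfIso c n P).inv ≫ cyclesMap g n = w := by
    rw [← cancel_mono (L.iCycles n), Category.assoc, cyclesMap_i]
    simp [g]
  rw [← h, Category.assoc, ← homologyπ_naturality, singleObjCyclesSelfIso_inv_homologyπ_assoc]

instance CochainComplex.isKProjective_single (P : C) [Projective P] (n : ℤ) :
    IsKProjective ((HomologicalComplex.single C (ComplexShape.up ℤ) n).obj P) := by
  have (i : ℤ) :
      Projective (((HomologicalComplex.single C (ComplexShape.up ℤ) n).obj P).X i) := by
    by_cases hi : i = n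
    · subst hi
      exact Projective.of_iso
        (HomologicalComplex.singleObjXSelf (ComplexShape.up ℤ) i P).symm ‹_›
    · exact (HomologicalComplex.isZero_single_obj_X _ _ _ _ hi).projective
  exact isKProjective_of_projective _ n

theorem CochainComplex.IsKProjective.Q_map_surjective [HasDerivedCategory C]
    (K L : CochainComplex C ℤ) [K.IsKProjective] :
    Function.Surjective (DerivedCategory.Q.map : (K ⟶ L) → _) := fun φ ↦ by
  obtain ⟨h, hh⟩ := (Qh_map_bijective K ((HomotopyCategory.quotient _ _).obj L)).surjective
    ((DerivedCategory.quotientCompQhIso C).hom.app K ≫ φ ≫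
      (DerivedCategory.quotientCompQhIso C).inv.app L)
  obtain ⟨g, rfl⟩ := (HomotopyCategory.quotient _ _).map_surjective h
  refine ⟨g, ?_⟩
  rw [← cancel_epi ((DerivedCategory.quotientCompQhIso C).hom.app K),
    ← cancel_mono ((DerivedCategory.quotientCompQhIso C).inv.app L), Category.assoc,
    Category.assoc, ← hh, ← DerivedCategory.quotientCompQhIso_hom_naturality_assoc]
  simp

end

open CategoryTheory in
theorem HomologicalComplex.homologyMap_smul {R C ι : Type*} [Semiring R] [Category* C]
    [Preadditive C] [Linear R C] {c : ComplexShape ι} {K L : HomologicalComplex C c} (a : R)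
    (g : K ⟶ L) (i : ι) [K.HasHomology i] [L.HasHomology i] :
    homologyMap (a • g) i = a • homologyMap g i :=
  ShortComplex.homologyMap_smul (φ := (shortComplexFunctor C c i).map g) a

section

open CategoryTheory Limits Pretriangulated

variable {R : Type*} [CommRing R] {C : Type*} [Category* C] [Preadditive C] [Linear R C]

/-- Every morphism `X ⟶ Y` is annihilated by some power of `a`. -/
def IsPowTorsionHom (a : R) (X Y : C) : Prop := ∀ φ : X ⟶ Y, ∃ k : ℕ, a ^ k • φ = 0

theorem IsPowTorsionHom.of_iso {a : R} {X X' Y Y' : C} (e : X ≅ X') (e' : Y ≅ Y')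
    (h : IsPowTorsionHom a X Y) : IsPowTorsionHom a X' Y' := fun φ ↦ by
  obtain ⟨k, hk⟩ := h (e.hom ≫ φ ≫ e'.inv)
  refine ⟨k, ?_⟩
  rw [← cancel_epi e.hom, ← cancel_mono e'.inv]
  simpa using hk

theorem IsPowTorsionHom.exists_smul_eq_zero {a : R} {X Y : C} (h : IsPowTorsionHom a X Y)
    {φ : X ⟶ Y} (hφ : φ ≠ 0) : ∃ ψ : X ⟶ Y, ψ ≠ 0 ∧ a • ψ = 0 := by
  classical
  have hk := Nat.find_spec (h φ)
  rcases hn : Nat.find (h φ) with _ | k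
  · rw [hn] at hk
    exact absurd (by simpa using hk) hφ
  · refine ⟨a ^ k • φ, Nat.find_min (h φ) (by lia), ?_⟩
    rwa [hn, pow_succ', mul_smul] at hk

variable [HasShift C ℤ] [∀ n : ℤ, (shiftFunctor C n).Additive]

theorem IsPowTorsionHom.shift [∀ n : ℤ, (shiftFunctor C n).Linear R]
    {a : R} {X Y : C} (n : ℤ) (h : IsPowTorsionHom a X Y) :
    IsPowTorsionHom a (X⟦n⟧) (Y⟦n⟧) := fun φ ↦ by
  obtain ⟨ψ, rfl⟩ := (shiftFunctor C n).map_surjective φ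
  obtain ⟨k, hk⟩ := h ψ
  exact ⟨k, by rw [← Functor.map_smul, hk, Functor.map_zero]⟩

variable [HasZeroObject C] [Pretriangulated C]

theorem IsPowTorsionHom.of_distTriang {a : R} {T : Triangle C} (hT : T ∈ distTriang C) {Y : C}
    (h₁ : IsPowTorsionHom a (T.obj₁⟦(1 : ℤ)⟧) Y) (h₂ : IsPowTorsionHom a T.obj₂ Y) :
    IsPowTorsionHom a T.obj₃ Y := fun φ ↦ by
  obtain ⟨k, hk⟩ := h₂ (T.mor₂ ≫ φ)
  obtain ⟨ψ, hψ⟩ := T.yoneda_exact₃ hT (a ^ k • φ) (by rw [Linear.comp_smul, hk])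
  obtain ⟨l, hl⟩ := h₁ ψ
  exact ⟨l + k, by rw [pow_add, mul_smul, hψ, ← Linear.comp_smul, hl, comp_zero]⟩

/-- A nonzero morphism from `X` yields a nonzero morphism from the cone of `a : X ⟶ X`, provided
the morphisms are `a`-power torsion. -/
theorem IsPowTorsionHom.exists_ne_zero_of_distTriang {a : R} {X Y Z : C} {f : X ⟶ X} {g : X ⟶ Z}
    {h : Z ⟶ X⟦(1 : ℤ)⟧} (hT : Triangle.mk f g h ∈ distTriang C) (hf : f = a • 𝟙 X)
    (hX : IsPowTorsionHom a X Y) {φ : X ⟶ Y} (hφ : φ ≠ 0) : ∃ ψ : Z ⟶ Y, ψ ≠ 0 := by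
  obtain ⟨φ', hφ', h0⟩ := hX.exists_smul_eq_zero hφ
  have hfφ : f ≫ φ' = 0 := by rw [hf, Linear.smul_comp, Category.id_comp, h0]
  obtain ⟨ψ, hψ⟩ := Triangle.yoneda_exact₂ _ hT φ' hfφ
  refine ⟨ψ, ?_⟩
  rintro rfl
  exact hφ' (hψ.trans comp_zero)

end

section

open CategoryTheory Limits Pretriangulated DerivedCategory

variable {R : Type u} [CommRing R]

theorem IsIdealTorsion.of_iso {I : Ideal R} {M N : ModuleCat.{u} R} (e : M ≅ N)
    (hN : IsIdealTorsion R I N) : IsIdealTorsion R I M := fun x ↦ by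
  obtain ⟨k, hk⟩ := hN (e.hom x)
  refine ⟨k, fun a ha ↦ e.toLinearEquiv.injective ?_⟩
  rw [map_smul, map_zero]
  exact hk a ha

variable [HasDerivedCategory.{u + 1} (ModuleCat.{u} R)]

theorem isPowTorsionHom_singleR {I : Ideal R} {a : R} (ha : a ∈ I)
    {L : CochainComplex (ModuleCat.{u} R) ℤ} (hL : IsIdealTorsion R I (L.homology 0)) :
    IsPowTorsionHom a (Q.obj (singleR R)) (Q.obj L) := fun φ ↦ by
  unfold singleR at φ
  have : Projective (ModuleCat.of R R) :=
    ModuleCat.projective_of_free (Module.Basis.singleton Unit R)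
  obtain ⟨g, rfl⟩ := CochainComplex.IsKProjective.Q_map_surjective _ _ φ
  let e := HomologicalComplex.singleObjHomologySelfIso (ComplexShape.up ℤ) 0 (ModuleCat.of R R)
  obtain ⟨k, hk⟩ := hL ((e.inv ≫ HomologicalComplex.homologyMap g 0).hom (1 : R))
  refine ⟨k, ?_⟩
  have h : HomologicalComplex.homologyMap (a ^ k • g) 0 = 0 := by
    rw [HomologicalComplex.homologyMap_smul, ← cancel_epi e.inv, Linear.comp_smul, comp_zero]
    ext
    exact hk _ (Ideal.pow_mem_pow ha k)
  obtain ⟨H⟩ := CochainComplex.nonempty_homotopy_zero_of_homologyMap_eq_zero (a ^ k • g) h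
  exact (Q.map_smul (a ^ k) g).symm.trans
    ((Q_map_eq_of_homotopy _ H).trans (Functor.map_zero _ _ _))

theorem exists_singleR_hom_ne_zero {L : CochainComplex (ModuleCat.{u} R) ℤ}
    (hL : ¬ IsZero (L.homology 0)) : ∃ φ : Q.obj (singleR R) ⟶ Q.obj L, φ ≠ 0 := by
  rw [ModuleCat.isZero_iff_subsingleton, not_subsingleton_iff_nontrivial] at hL
  obtain ⟨x, hx⟩ := exists_ne (0 : L.homology 0)
  obtain ⟨z, rfl⟩ := (ModuleCat.epi_iff_surjective (L.homologyπ 0)).1 inferInstance x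
  let w : ModuleCat.of R R ⟶ L.cycles 0 :=
    ModuleCat.ofHom (LinearMap.toSpanSingleton R (L.cycles 0 : ModuleCat R) z)
  obtain ⟨g, hg⟩ := HomologicalComplex.exists_single_hom w
  refine ⟨Q.map g, fun h ↦ hx ?_⟩
  have hg' : HomologicalComplex.homologyMap g 0 = 0 := by
    have := homologyFunctorFactors_hom_naturality g 0
    erw [h, Functor.map_zero, zero_comp] at this
    exact (cancel_epi ((homologyFunctorFactors (ModuleCat.{u} R) 0).hom.app _)).1
      (this.symm.trans comp_zero.symm)
  rw [hg', comp_zero] at hg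
  have hw : L.homologyπ 0 (w (1 : R)) = 0 := congrArg (fun f ↦ f (1 : R)) hg.symm
  rwa [show w (1 : R) = z from one_smul R z] at hw

/-- The shift of a complex computes its homology in degree zero. -/
noncomputable def homologyShiftIso (E : CochainComplex (ModuleCat.{u} R) ℤ) (j : ℤ) :
    (E⟦j⟧).homology 0 ≅ E.homology j :=
  ((HomologicalComplex.homologyFunctor (ModuleCat.{u} R) (ComplexShape.up ℤ) 0).shiftIso
    j 0 j (add_zero j)).app E

theorem isPowTorsionHom_koszul {I : Ideal R} {E : CochainComplex (ModuleCat.{u} R) ℤ} {a : R}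
    (ha : a ∈ I) (l : List R) (n : ℤ)
    (hE : ∀ i : ℤ, n ≤ i → IsIdealTorsion R I (E.homology i))
    (j : ℤ) (hj : n + l.length ≤ j) :
    IsPowTorsionHom a (Q.obj (koszul R l)) ((Q.obj E)⟦j⟧) := by
  induction l generalizing j with
  | nil =>
    exact (isPowTorsionHom_singleR ha
      ((hE j (by simpa using hj)).of_iso (homologyShiftIso E j))).of_iso (Iso.refl _)
        ((Q.commShiftIso j).app E)
  | cons b l ih =>
    simp only [List.length_cons, Nat.cast_add, Nat.cast_one] at hj
    have hT := mappingCone_triangle_distinguished (b • 𝟙 (koszul R l))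
    refine IsPowTorsionHom.of_distTriang hT ?_ (ih j (by lia))
    exact ((ih (j - 1) (by lia)).shift 1).of_iso (Iso.refl _)
      ((shiftFunctorAdd' (DerivedCategory (ModuleCat.{u} R)) (j - 1) 1 j (by lia)).app _).symm

theorem exists_koszul_hom_ne_zero {I : Ideal R} {E : CochainComplex (ModuleCat.{u} R) ℤ}
    (l : List R) (hl : ∀ a ∈ l, a ∈ I) (n : ℤ)
    (hE : ∀ i : ℤ, n ≤ i → IsIdealTorsion R I (E.homology i))
    (j : ℤ) (hj : n + l.length ≤ j) (hne : ¬ IsZero (E.homology j)) :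
    ∃ φ : Q.obj (koszul R l) ⟶ (Q.obj E)⟦j⟧, φ ≠ 0 := by
  induction l with
  | nil =>
    obtain ⟨φ, hφ⟩ := exists_singleR_hom_ne_zero (L := E⟦j⟧)
      (fun h ↦ hne (h.of_iso (homologyShiftIso E j).symm))
    exact ⟨φ ≫ (Q.commShiftIso j).hom.app E,
      fun h ↦ hφ ((cancel_mono _).1 (h.trans zero_comp.symm))⟩
  | cons b l ih =>
    simp only [List.length_cons, Nat.cast_add, Nat.cast_one] at hj
    obtain ⟨φ, hφ⟩ := ih (fun a ha ↦ hl a (List.mem_cons_of_mem _ ha)) (by lia)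
    have hT := mappingCone_triangle_distinguished (b • 𝟙 (koszul R l))
    have hb : Q.map (b • 𝟙 (koszul R l)) = b • 𝟙 (Q.obj (koszul R l)) := by
      rw [Functor.map_smul, CategoryTheory.Functor.map_id]
    exact (isPowTorsionHom_koszul (hl b List.mem_cons_self) l n hE j
      (by lia)).exists_ne_zero_of_distTriang hT hb hφ

end

open DerivedCategory CategoryTheory.Limits in
/-- **Corollary 5.8(ii) of Lipman–Neeman.** Let `I = (f₁, …, f_r)R`, let `m ∈ ℤ`, and let
`E` be an `R`-complex with `H^i(E)` an `I`-torsion module for all `i ≥ m − r`.  Then for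
every integer `i ≥ m` with `H^i(E) ≠ 0` there is a nonzero morphism
`K_•(f₁, …, f_r)[−i] ⟶ E` in `D(R)`. -/
theorem statement_17 (R : Type u) [CommRing R]
    [HasDerivedCategory.{u + 1} (ModuleCat.{u} R)]
    (r : ℕ) (f : Fin r → R) (m : ℤ)
    (E : CochainComplex (ModuleCat.{u} R) ℤ)
    (hE : ∀ i : ℤ, m - (r : ℤ) ≤ i →
      IsIdealTorsion R (Ideal.span (Set.range f)) (E.homology i))
    (i : ℤ) (hi : m ≤ i) (hne : ¬ IsZero (E.homology i)) :
    ∃ g : (Q.obj (koszul R (List.ofFn f)))⟦(-i : ℤ)⟧ ⟶ Q.obj E, g ≠ 0 := by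
  obtain ⟨φ, hφ⟩ := exists_koszul_hom_ne_zero (List.ofFn f)
    (fun a ha ↦ Ideal.subset_span (by simpa using ha)) (m - r) hE i (by simpa using hi) hne
  refine ⟨φ⟦(-i : ℤ)⟧' ≫ (shiftShiftNeg (Q.obj E) i).hom, fun h ↦ hφ ?_⟩
  have h' : φ⟦(-i : ℤ)⟧' = 0 :=
    (cancel_mono (shiftShiftNeg (Q.obj E) i).hom).1 (h.trans zero_comp.symm)
  exact (shiftFunctor _ (-i)).map_injective (h'.trans (Functor.map_zero _ _ _).symm)
end
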